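/- Let L_1, …, L_n be simple closure spaces, L_i on Σ_i, each coatomistic and weakly connected, and let L ∈ S(L_1,…,L_n) be a weak tensor product. If L is transitive and admits an orthocomplementation, then L = ∧○_{i=1}^n L_i. -/

import Mathlib

open Set

namespace QLTensor

universe u v w

/-- A simple closure space on `X`: a set of subsets of `X`, closed under arbitrary
set-intersections, containing `∅`, `univ` and all singletons. -/
def IsSCS {X : Type*} (L : Set (Set X)) : Prop :=
  (∀ ω ⊆ L, ⋂₀ ω ∈ L) ∧ ∅ ∈ L ∧ Set.univ ∈ L ∧ ∀ p : X, ({p} : Set X) ∈ L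

/-- The join in a simple closure space: `⋁ A = ⋂ {b ∈ L | A ⊆ b}`. -/
def cl {X : Type*} (L : Set (Set X)) (A : Set X) : Set X :=
  ⋂₀ {b | b ∈ L ∧ A ⊆ b}

/-- `b` covers `a` in the lattice `L` (both belonging to `L`). -/
def CoversIn {X : Type*} (L : Set (Set X)) (a b : Set X) : Prop :=
  a ∈ L ∧ b ∈ L ∧ a ⊂ b ∧ ∀ c ∈ L, a ⊂ c → c ⊂ b → False

/-- `x` is a coatom of `L` (covered by the top element `univ`). -/
def IsCoatomIn {X : Type*} (L : Set (Set X)) (x : Set X) : Prop :=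
  x ∈ L ∧ x ≠ Set.univ ∧ ∀ c ∈ L, x ⊂ c → c = Set.univ

/-- `L` is coatomistic: every element is an intersection of coatoms. -/
def Coatomistic {X : Type*} (L : Set (Set X)) : Prop :=
  ∀ a ∈ L, a = ⋂₀ {x | IsCoatomIn L x ∧ a ⊆ x}

/-- The covering property: if `p ∧ a = 0` then `p ∨ a` covers `a`. -/
def CovProp {X : Type*} (L : Set (Set X)) : Prop :=
  ∀ p : X, ∀ a ∈ L, p ∉ a → CoversIn L a (cl L (insert p a))

/-- The covering property of the dual lattice. -/
def DualCovProp {X : Type*} (L : Set (Set X)) : Prop :=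
  ∀ x : Set X, IsCoatomIn L x → ∀ a ∈ L, cl L (a ∪ x) = Set.univ →
    CoversIn L (a ∩ x) a

/-- A DAC-lattice: `L` and its dual are atomistic with the covering property
(a simple closure space is automatically atomistic). -/
def IsDAC {X : Type*} (L : Set (Set X)) : Prop :=
  CovProp L ∧ Coatomistic L ∧ DualCovProp L

/-- `(a, b)` is a modular pair: `(c ∨ a) ∧ b = c ∨ (a ∧ b)` for all `c ≤ b`. -/
def ModularPairIn {X : Type*} (L : Set (Set X)) (a b : Set X) : Prop :=
  ∀ c ∈ L, c ⊆ b → cl L (c ∪ a) ∩ b = cl L (c ∪ a ∩ b)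

/-- `z` is a central element of the simple closure space `L`. -/
def IsCentralIn {X : Type*} (L : Set (Set X)) (z : Set X) : Prop :=
  zᶜ ∈ L ∧ ModularPairIn L z zᶜ ∧ ModularPairIn L zᶜ z

/-- `L` is irreducible: its only central elements are `∅` and `univ`. -/
def IrreducibleSCS {X : Type*} (L : Set (Set X)) : Prop :=
  ∀ z ∈ L, IsCentralIn L z → z = ∅ ∨ z = Set.univ

/-- `N` is an orthocomplementation of the simple closure space `L`. -/
def IsOrtho {X : Type*} (L : Set (Set X)) (N : Set X → Set X) : Prop :=
  (∀ a ∈ L, N a ∈ L) ∧ (∀ a ∈ L, N (N a) = a) ∧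
  (∀ a ∈ L, ∀ b ∈ L, a ⊆ b → N b ⊆ N a) ∧
  ∀ a ∈ L, cl L (a ∪ N a) = Set.univ

/-- `L` with orthocomplementation `N` is orthomodular. -/
def OrthomodularIn {X : Type*} (L : Set (Set X)) (N : Set X → Set X) : Prop :=
  ∀ a ∈ L, ∀ b ∈ L, a ⊆ b → b = cl L (a ∪ b ∩ N a)

/-- `L` contains `MO₃`. -/
def ContainsMO3 {X : Type*} (L : Set (Set X)) : Prop :=
  ∃ p q r : X, p ≠ q ∧ p ≠ r ∧ q ≠ r ∧
    CoversIn L {p} (cl L {p, q}) ∧ CoversIn L {q} (cl L {p, q}) ∧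
    CoversIn L {r} (cl L {p, q})

/-- `L` contains `MO₄`. -/
def ContainsMO4 {X : Type*} (L : Set (Set X)) : Prop :=
  ∃ p₁ p₂ p₃ p₄ : X,
    p₁ ≠ p₂ ∧ p₁ ≠ p₃ ∧ p₁ ≠ p₄ ∧ p₂ ≠ p₃ ∧ p₂ ≠ p₄ ∧ p₃ ≠ p₄ ∧
    CoversIn L {p₁} (cl L {p₁, p₄}) ∧ CoversIn L {p₂} (cl L {p₁, p₄}) ∧
    CoversIn L {p₃} (cl L {p₁, p₄}) ∧ CoversIn L {p₄} (cl L {p₁, p₄})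

/-- `L` is connected. -/
def ConnectedSCS {X : Type*} (L : Set (Set X)) : Prop :=
  (∃ p q : X, p ≠ q) ∧
  ∀ p q : X, p ≠ q → ∃ r : X, r ≠ p ∧ r ≠ q ∧ r ∈ cl L {p, q} ∧
    p ∈ cl L {q, r} ∧ q ∈ cl L {p, r}

/-- `L` is weakly connected: `L ≠ 2` and the point set admits a connected covering. -/
def WeaklyConnected {X : Type*} (L : Set (Set X)) : Prop :=
  (∃ p q : X, p ≠ q) ∧
  ∃ 𝒜 : Set (Set X),
    ⋃₀ 𝒜 = Set.univ ∧
    (∀ A ∈ 𝒜, ∃ p ∈ A, ∃ q ∈ A, p ≠ q) ∧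
    (∀ A ∈ 𝒜, ∀ p ∈ A, ∀ q ∈ A, p ≠ q → ∃ r, r ≠ p ∧ r ≠ q ∧ r ∈ cl L {p, q}) ∧
    ∀ p q : X, ∃ (m : ℕ) (c : Fin (m + 1) → Set X),
      (∀ i, c i ∈ 𝒜) ∧ p ∈ c 0 ∧ q ∈ c (Fin.last m) ∧
      ∀ i : Fin m, ∃ x ∈ c i.castSucc ∩ c i.succ, ∃ y ∈ c i.castSucc ∩ c i.succ, x ≠ y

/-- The central cover `e(p)` of an atom `p`. -/
def centralCover {X : Type*} (L : Set (Set X)) (p : X) : Set X :=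
  ⋂₀ {z | z ∈ L ∧ IsCentralIn L z ∧ p ∈ z}

/-- The interval `[0, e]` of `L`, viewed as a simple closure space on `e`. -/
def restrictSCS {X : Type*} (L : Set (Set X)) (e : Set X) : Set (Set ↥e) :=
  {B | Subtype.val '' B ∈ L}

/-- The automorphism group of `M` acts transitively on points. -/
def TransitiveSCS {X : Type*} (M : Set (Set X)) : Prop :=
  ∀ p q : X, ∃ u : X ≃ X, (∀ a : Set X, a ∈ M ↔ u '' a ∈ M) ∧ u p = q

section Pi

variable {Ω : Type*} {σ : Ω → Type*}

/-- `⋃_α π_α⁻¹ (a α)`. -/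
def unionCyl (a : ∀ α, Set (σ α)) : Set (∀ α, σ α) :=
  {p | ∃ α, p α ∈ a α}

/-- `∏_α a_α`. -/
def prodSet (a : ∀ α, Set (σ α)) : Set (∀ α, σ α) :=
  {p | ∀ α, p α ∈ a α}

/-- `p[A, β]`. -/
def cylSet (p : ∀ α, σ α) (β : Ω) (A : Set (σ β)) : Set (∀ α, σ α) :=
  {q | q β ∈ A ∧ ∀ α, α ≠ β → q α = p α}

/-- `R_β[p]`. -/
def secSet (R : Set (∀ α, σ α)) (β : Ω) (p : ∀ α, σ α) : Set (σ β) :=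
  {x | ∃ q ∈ R, q β = x ∧ ∀ α, α ≠ β → q α = p α}

/-- The separated product `∧○_α L_α`. -/
def wedgeO (L : ∀ α, Set (Set (σ α))) : Set (Set (∀ α, σ α)) :=
  {S | ∃ ω : Set (Set (∀ α, σ α)),
    (∀ y ∈ ω, ∃ a : ∀ α, Set (σ α), (∀ α, a α ∈ L α) ∧ y = unionCyl a) ∧ S = ⋂₀ ω}

/-- The product `∨○_α L_α`. -/
def veeO (L : ∀ α, Set (Set (σ α))) : Set (Set (∀ α, σ α)) :=
  {R | ∀ (β : Ω) (p : ∀ α, σ α), secSet R β p ∈ L β}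

/-- Axiom P2. -/
def AxiomP2 (L : ∀ α, Set (Set (σ α))) (M : Set (Set (∀ α, σ α))) : Prop :=
  ∀ a : ∀ α, Set (σ α), (∀ α, a α ∈ L α) → unionCyl a ∈ M

/-- Axiom P3. -/
def AxiomP3 (L : ∀ α, Set (Set (σ α))) (M : Set (Set (∀ α, σ α))) : Prop :=
  ∀ (p : ∀ α, σ α) (β : Ω) (A : Set (σ β)), cylSet p β A ∈ M → A ∈ L β

/-- `M` is a weak tensor product of the family `L`, i.e. `M ∈ S(L_α, α ∈ Ω)`. -/
def IsWTP (L : ∀ α, Set (Set (σ α))) (M : Set (Set (∀ α, σ α))) : Prop :=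
  IsSCS M ∧ AxiomP2 L M ∧ AxiomP3 L M

/-- `p # q` iff `p_β ⊥_β q_β` for some `β`. -/
def hashRel (N : ∀ α, Set (σ α) → Set (σ α)) (p q : ∀ α, σ α) : Prop :=
  ∃ β, p β ∈ N β {q β}

/-- `R^#`. -/
def sharp (N : ∀ α, Set (σ α) → Set (σ α)) (R : Set (∀ α, σ α)) :
    Set (∀ α, σ α) :=
  {q | ∀ p ∈ R, hashRel N q p}

/-- A join-preserving map `u` is large. -/
def LargeMap (u : Set (∀ α, σ α) → Set (∀ α, σ α)) : Prop :=
  ∀ (β : Ω) (p : ∀ α, σ α),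
    (¬ ∃ x, u (cylSet p β Set.univ) = {x}) ∧ ¬ u Set.univ ⊆ {q | q β = p β}

end Pi

section Binary

variable {X Y : Type*}

/-- The binary product `L₁ ∨○ L₂`. -/
def veeO2 (L1 : Set (Set X)) (L2 : Set (Set Y)) : Set (Set (X × Y)) :=
  {R | (∀ y : Y, {x | (x, y) ∈ R} ∈ L1) ∧ ∀ x : X, {y | (x, y) ∈ R} ∈ L2}

/-- The binary separated product `L₁ ∧○ L₂`. -/
def wedgeO2 (L1 : Set (Set X)) (L2 : Set (Set Y)) : Set (Set (X × Y)) :=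
  {S | ∃ ω : Set (Set (X × Y)),
    (∀ y ∈ ω, ∃ a₁ ∈ L1, ∃ a₂ ∈ L2,
      y = a₁ ×ˢ (Set.univ : Set Y) ∪ (Set.univ : Set X) ×ˢ a₂) ∧
    S = ⋂₀ ω}

end Binary

section Aux

variable {n : ℕ} {σ : Fin n → Type*}

/-- `a` and `b` agree in every coordinate except possibly `j`. -/
def AgreeOff (j : Fin n) (a b : ∀ i, σ i) : Prop := ∀ i, i ≠ j → a i = b i

theorem mem_of_update_closed {P : (∀ i, σ i) → Prop} (q : ∀ i, σ i)
    (step : ∀ p i, P p → P (Function.update p i (q i))) {p : ∀ i, σ i} (hp : P p) : P q := by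
  classical
  have h : ∀ s : Finset (Fin n), P (fun i => if i ∈ s then q i else p i) := by
    intro s
    induction s using Finset.induction_on with
    | empty => simpa using hp
    | insert j s _ ih =>
      convert step _ j ih using 1
      funext i
      by_cases hi : i = j
      · subst hi; simp
      · simp [hi]
  simpa using h Finset.univ

theorem inter_mem {X : Type*} {L : Set (Set X)} (hL : IsSCS L) {a b : Set X}
    (ha : a ∈ L) (hb : b ∈ L) : a ∩ b ∈ L := by
  have := hL.1 {a, b} (by rintro x (rfl | rfl) <;> assumption)
  simpa using this

theorem cylSet_univ_mem {L : ∀ i, Set (Set (σ i))} (hL : ∀ i, IsSCS (L i))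
    {M : Set (Set (∀ i, σ i))} (hM : IsWTP L M) (p : ∀ i, σ i) (β : Fin n) :
    cylSet p β Set.univ ∈ M := by
  classical
  have key : cylSet p β Set.univ =
      ⋂₀ {y | ∃ α, α ≠ β ∧ y = unionCyl (fun i => if i = α then {p i} else ∅)} := by
    ext q
    constructor
    · rintro ⟨-, hq⟩ _ ⟨α, hα, rfl⟩
      exact ⟨α, by simp [hq α hα]⟩
    · intro hq
      refine ⟨trivial, fun α hα => ?_⟩
      obtain ⟨i, hi⟩ := hq _ ⟨α, hα, rfl⟩
      by_cases h : i = α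
      · subst h; simpa using hi
      · simp [h] at hi
  rw [key]
  refine hM.1.1 _ ?_
  rintro _ ⟨α, -, rfl⟩
  refine hM.2.1 _ fun i => ?_
  split_ifs
  · exact (hL i).2.2.2 _
  · exact (hL i).2.1

theorem section_mem {L : ∀ i, Set (Set (σ i))} (hL : ∀ i, IsSCS (L i))
    {M : Set (Set (∀ i, σ i))} (hM : IsWTP L M) (p : ∀ i, σ i) (β : Fin n)
    {b : Set (∀ i, σ i)} (hb : b ∈ M) :
    {x | Function.update p β x ∈ b} ∈ L β := by
  refine hM.2.2 p β _ ?_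
  have key : cylSet p β {x | Function.update p β x ∈ b} = b ∩ cylSet p β Set.univ := by
    ext q
    have hu : (∀ α, α ≠ β → q α = p α) → Function.update p β (q β) = q := by
      intro h
      funext i
      by_cases hi : i = β
      · subst hi; simp
      · simp [hi, h i hi]
    constructor
    · rintro ⟨h1, h2⟩
      rw [mem_ofPred_eq, hu h2] at h1
      exact ⟨h1, trivial, h2⟩
    · rintro ⟨h1, -, h2⟩
      refine ⟨?_, h2⟩
      rwa [mem_ofPred_eq, hu h2]
  rw [key]
  exact inter_mem hM.1 hb (cylSet_univ_mem hL hM p β)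

theorem agree_of_mem_cl_pair {L : ∀ i, Set (Set (σ i))} (hL : ∀ i, IsSCS (L i))
    {M : Set (Set (∀ i, σ i))} (hM : IsWTP L M) {a b r : ∀ i, σ i}
    (hr : r ∈ cl M {a, b}) {γ δ : Fin n} (hγ : r γ ≠ a γ) (hδ : δ ≠ γ) : r δ = b δ := by
  classical
  have hmem : unionCyl (fun i => if i = γ then {a i} else if i = δ then {b i} else ∅) ∈ M := by
    refine hM.2.1 _ fun i => ?_
    split_ifs
    · exact (hL i).2.2.2 _
    · exact (hL i).2.2.2 _
    · exact (hL i).2.1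
  obtain ⟨i, hi⟩ := hr _ ⟨hmem, by
    rintro x (rfl | rfl)
    · exact ⟨γ, by simp⟩
    · exact ⟨δ, by simp [hδ]⟩⟩
  by_cases h1 : i = γ
  · subst h1
    exact absurd (by simpa using hi) hγ
  · by_cases h2 : i = δ
    · subst h2
      simpa [h1] using hi
    · simp [h1, h2] at hi

theorem agreeOff_of_third {L : ∀ i, Set (Set (σ i))} (hL : ∀ i, IsSCS (L i))
    {M : Set (Set (∀ i, σ i))} (hM : IsWTP L M) {a b r : ∀ i, σ i}
    (hr : r ∈ cl M {a, b}) (hra : r ≠ a) (hrb : r ≠ b) : ∃ j, AgreeOff j a b := by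
  obtain ⟨γ, hγ⟩ := Function.ne_iff.1 hra
  have h1 : ∀ δ, δ ≠ γ → r δ = b δ := fun δ hδ => agree_of_mem_cl_pair hL hM hr hγ hδ
  have hγb : r γ ≠ b γ := by
    intro h
    refine hrb (funext fun δ => ?_)
    by_cases hδ : δ = γ
    · subst hδ; exact h
    · exact h1 δ hδ
  rw [Set.pair_comm] at hr
  exact ⟨γ, fun δ hδ => (agree_of_mem_cl_pair hL hM hr hγb hδ).symm.trans (h1 δ hδ)⟩

theorem update_mem_cl {L : ∀ i, Set (Set (σ i))} (hL : ∀ i, IsSCS (L i))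
    {M : Set (Set (∀ i, σ i))} (hM : IsWTP L M) (p : ∀ i, σ i) (β : Fin n)
    {s t r : σ β} (hr : r ∈ cl (L β) {s, t}) :
    Function.update p β r ∈ cl M {Function.update p β s, Function.update p β t} := by
  rintro b ⟨hb, hsub⟩
  refine hr {x | Function.update p β x ∈ b} ⟨section_mem hL hM p β hb, ?_⟩
  rintro x (rfl | rfl)
  · exact hsub (by simp)
  · exact hsub (by simp)

theorem map_mem_cl {X : Type*} {M : Set (Set X)} {u : X → X} (hu : ∀ a ∈ M, u ⁻¹' a ∈ M)
    {S : Set X} {r : X} (hr : r ∈ cl M S) : u r ∈ cl M (u '' S) := by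
  rintro b ⟨hb, hsub⟩
  exact hr _ ⟨hu b hb, image_subset_iff.1 hsub⟩

/-- A family of points, pairwise agreeing off one coordinate and containing two distinct
points, varies in a single coordinate. -/
theorem exists_common_coordinate {Y : Type*} {l : Y → ∀ i, σ i} {A : Set Y}
    (hA : ∀ s ∈ A, ∀ t ∈ A, s ≠ t → ∃ j, AgreeOff j (l s) (l t))
    {p q : Y} (hp : p ∈ A) (hq : q ∈ A) (hpq : l p ≠ l q) :
    ∃ j, ∀ s ∈ A, ∀ t ∈ A, AgreeOff j (l s) (l t) := by
  obtain ⟨j, hj⟩ := hA p hp q hq (fun h => hpq (h ▸ rfl))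
  have hjne : l p j ≠ l q j := by
    intro h
    refine hpq (funext fun i => ?_)
    by_cases hi : i = j
    · subst hi; exact h
    · exact hj i hi
  have key : ∀ s ∈ A, AgreeOff j (l s) (l p) := by
    intro s hs i hi
    by_cases hsp : s = p
    · rw [hsp]
    by_cases hsq : s = q
    · rw [hsq]; exact (hj i hi).symm
    obtain ⟨j₁, h₁⟩ := hA s hs p hp hsp
    obtain ⟨j₂, h₂⟩ := hA s hs q hq hsq
    by_cases hij : i = j₁
    · have hj₁ : l s j = l p j := h₁ j (fun h => hi (hij.trans h.symm))
      have hj₂ : j = j₂ := by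
        by_contra h
        exact hjne (hj₁.symm.trans (h₂ j h))
      exact (h₂ i (hj₂ ▸ hi)).trans (hj i hi).symm
    · exact h₁ i hij
  exact ⟨j, fun s hs t ht i hi => (key s hs i hi).trans (key t ht i hi).symm⟩

theorem agreeOff_image_update {L : ∀ i, Set (Set (σ i))} (hL : ∀ i, IsSCS (L i))
    (hwc : ∀ i, WeaklyConnected (L i))
    {M : Set (Set (∀ i, σ i))} (hM : IsWTP L M)
    {u : (∀ i, σ i) → ∀ i, σ i} (hinj : Function.Injective u) (hu : ∀ a ∈ M, u ⁻¹' a ∈ M)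
    (p : ∀ i, σ i) (β : Fin n) (t : σ β) :
    ∃ j, AgreeOff j (u p) (u (Function.update p β t)) := by
  obtain ⟨-, 𝒜, -, htwo, hthird, hchain⟩ := hwc β
  set l : σ β → ∀ i, σ i := fun x => u (Function.update p β x) with hl
  have hlinj : Function.Injective l := hinj.comp (Function.update_injective p β)
  have hpair : ∀ A ∈ 𝒜, ∀ s ∈ A, ∀ t ∈ A, s ≠ t → ∃ j, AgreeOff j (l s) (l t) := by
    intro A hA s hs t ht hst
    obtain ⟨r, hrs, hrt, hr⟩ := hthird A hA s hs t ht hst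
    have h := map_mem_cl hu (update_mem_cl hL hM p β hr)
    rw [image_pair] at h
    exact agreeOff_of_third hL hM h (hlinj.ne hrs) (hlinj.ne hrt)
  have hcoord : ∀ A ∈ 𝒜, ∃ j, ∀ s ∈ A, ∀ t ∈ A, AgreeOff j (l s) (l t) := by
    intro A hA
    obtain ⟨x, hx, y, hy, hxy⟩ := htwo A hA
    exact exists_common_coordinate (hpair A hA) hx hy (hlinj.ne hxy)
  obtain ⟨m, c, hc, hp0, htm, hov⟩ := hchain (p β) t
  obtain ⟨j, hj⟩ := hcoord _ (hc 0)
  have key : ∀ i : Fin (m + 1), ∀ s ∈ c i, ∀ s' ∈ c i,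
      AgreeOff j (l (p β)) (l s) ∧ AgreeOff j (l s) (l s') := by
    intro i
    induction i using Fin.induction with
    | zero => exact fun s hs s' hs' => ⟨hj _ hp0 s hs, hj s hs s' hs'⟩
    | succ i ih =>
      obtain ⟨x, hx, y, hy, hxy⟩ := hov i
      obtain ⟨k, hk⟩ := hcoord _ (hc i.succ)
      obtain ⟨hpx, hxy'⟩ := ih x hx.1 y hy.1
      have hkj : k = j := by
        by_contra hne
        refine hlinj.ne hxy (funext fun a => ?_)
        by_cases ha : a = j
        · exact hk x hx.2 y hy.2 a (fun h => hne (h.symm.trans ha))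
        · exact hxy' a ha
      subst hkj
      exact fun s hs s' hs' =>
        ⟨fun a ha => (hpx a ha).trans (hk x hx.2 s hs a ha), hk s hs s' hs'⟩
  refine ⟨j, ?_⟩
  have h := (key (Fin.last m) t htm t htm).1
  simpa [hl] using h

open Classical in
theorem hammingDist_le_one_of_agreeOff {j : Fin n} {a b : ∀ i, σ i} (h : AgreeOff j a b) :
    hammingDist a b ≤ 1 := by
  unfold hammingDist
  refine (Finset.card_le_card (t := {j}) fun i hi => ?_).trans (by simp)
  by_contra hij
  exact (Finset.mem_filter.1 hi).2 (h i (by simpa using hij))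

open Classical in
theorem hammingDist_add_eq_iff {p r q : ∀ i, σ i} :
    hammingDist p r + hammingDist r q = hammingDist p q ↔ ∀ i, r i = p i ∨ r i = q i := by
  simp only [hammingDist, Finset.card_filter, ← Finset.sum_add_distrib]
  rw [eq_comm, Finset.sum_eq_sum_iff_of_le]
  · refine ⟨fun h i => ?_, fun h i _ => ?_⟩
    · have := h i (Finset.mem_univ i)
      grind
    · have := h i
      grind
  · intro i _
    grind

open Classical in
theorem hammingDist_map_le {u : (∀ i, σ i) → ∀ i, σ i}
    (hu : ∀ p β (t : σ β), ∃ j, AgreeOff j (u p) (u (Function.update p β t)))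
    (p q : ∀ i, σ i) : hammingDist (u p) (u q) ≤ hammingDist p q := by
  induction hk : hammingDist p q using Nat.strong_induction_on generalizing p with
  | _ k ih =>
    by_cases hpq : p = q
    · subst hpq; simp
    obtain ⟨i, hi⟩ := Function.ne_iff.1 hpq
    set r := Function.update p i (q i) with hr
    have hadd : hammingDist p r + hammingDist r q = hammingDist p q := by
      refine hammingDist_add_eq_iff.2 fun a => ?_
      by_cases ha : a = i
      · subst ha; simp [hr]
      · simp [hr, ha]
    have hpos : 0 < hammingDist p r := by
      refine hammingDist_pos.2 fun h => hi ?_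
      have := congrFun h i
      simpa [hr] using this
    obtain ⟨j, hj⟩ := hu p i (q i)
    have h1 := hammingDist_le_one_of_agreeOff hj
    have h2 := ih (hammingDist r q) (by omega) r rfl
    have h3 := hammingDist_triangle (u p) (u r) (u q)
    rw [← hr] at h1
    omega

/-- A nonempty set closed under mixing coordinates of two of its points is a box. -/
theorem mem_of_mixing_closed {C : Set (∀ i, σ i)} (hne : C.Nonempty)
    (hC : ∀ a ∈ C, ∀ b ∈ C, ∀ r, (∀ i, r i = a i ∨ r i = b i) → r ∈ C)
    {r : ∀ i, σ i} (hr : ∀ i, ∃ b ∈ C, b i = r i) : r ∈ C := by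
  obtain ⟨c, hc⟩ := hne
  refine mem_of_update_closed (P := (· ∈ C)) r (fun p i hp => ?_) hc
  obtain ⟨b, hb, hbi⟩ := hr i
  refine hC p hp b hb _ fun k => ?_
  by_cases hk : k = i
  · subst hk; simp [hbi]
  · simp [hk]

theorem preimage_unionCyl_eq {L : ∀ i, Set (Set (σ i))} (hL : ∀ i, IsSCS (L i))
    (hwc : ∀ i, WeaklyConnected (L i))
    {M : Set (Set (∀ i, σ i))} (hM : IsWTP L M) (u : (∀ i, σ i) ≃ ∀ i, σ i)
    (hu : ∀ a ∈ M, u ⁻¹' a ∈ M) (hu' : ∀ a ∈ M, u.symm ⁻¹' a ∈ M)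
    {x : ∀ i, Set (σ i)} (hx : ∀ i, x i ∈ L i) (hne : (unionCyl x) ≠ Set.univ) :
    ∃ y : ∀ i, Set (σ i), (∀ i, y i ∈ L i) ∧ u ⁻¹' unionCyl x = unionCyl y := by
  classical
  have hle := hammingDist_map_le (agreeOff_image_update hL hwc hM u.injective hu)
  have hle' := hammingDist_map_le (agreeOff_image_update hL hwc hM u.symm.injective hu')
  have hiso : ∀ p q, hammingDist (u p) (u q) = hammingDist p q := fun p q =>
    le_antisymm (hle p q) (by simpa using hle' (u p) (u q))
  set C : Set (∀ i, σ i) := (u ⁻¹' unionCyl x)ᶜ with hCdef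
  have hCne : C.Nonempty := by
    obtain ⟨p, hp⟩ := (ne_univ_iff_exists_notMem _).1 hne
    exact ⟨u.symm p, by simpa [hCdef] using hp⟩
  have hmix : ∀ a ∈ C, ∀ b ∈ C, ∀ r, (∀ i, r i = a i ∨ r i = b i) → r ∈ C := by
    intro a ha b hb r hr
    have h := hammingDist_add_eq_iff.2 hr
    rw [← hiso, ← hiso r, ← hiso a] at h
    have h' := hammingDist_add_eq_iff.1 h
    rintro ⟨i, hi⟩
    rcases h' i with h | h
    · exact ha ⟨i, h ▸ hi⟩
    · exact hb ⟨i, h ▸ hi⟩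
  have hbox : ∀ r, (∀ i, ∃ b ∈ C, b i = r i) → r ∈ C := fun r =>
    mem_of_mixing_closed hCne hmix
  obtain ⟨p, hp⟩ := hCne
  refine ⟨fun i => {t | ∀ b ∈ C, b i ≠ t}, fun i => ?_, ?_⟩
  · have h := section_mem hL hM p i (hu _ (hM.2.1 x hx))
    convert h using 1
    ext t
    rw [mem_ofPred_eq, mem_ofPred_eq]
    constructor
    · intro ht
      by_contra hmem
      exact ht _ hmem (by simp)
    · intro ht b hb hbt
      refine hbox (Function.update p i t) (fun k => ?_) ht
      by_cases hk : k = i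
      · subst hk; exact ⟨b, hb, by simpa using hbt⟩
      · exact ⟨p, hp, by simp [hk]⟩
  · ext r
    constructor
    · intro hr
      by_contra hn
      refine hbox r (fun i => ?_) hr
      by_contra hi
      push Not at hi
      exact hn ⟨i, hi⟩
    · rintro ⟨i, hi⟩
      by_contra hr
      exact hi r hr rfl

theorem eq_univ_of_unionCyl_subset {L : ∀ i, Set (Set (σ i))} (hL : ∀ i, IsSCS (L i))
    {M : Set (Set (∀ i, σ i))} (hM : IsWTP L M) {x : ∀ i, Set (σ i)}
    (hx : ∀ i, IsCoatomIn (L i) (x i)) {b : Set (∀ i, σ i)} (hb : b ∈ M)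
    (hsub : unionCyl x ⊆ b) {p : ∀ i, σ i} (hpb : p ∈ b) (hpx : p ∉ unionCyl x) :
    b = Set.univ := by
  refine eq_univ_of_forall fun q => ?_
  by_cases hq : q ∈ unionCyl x
  · exact hsub hq
  refine (mem_of_update_closed (P := fun r => r ∈ b ∧ r ∉ unionCyl x) q ?_ ⟨hpb, hpx⟩).1
  rintro r i ⟨hrb, hrx⟩
  refine ⟨?_, ?_⟩
  · have hss : x i ⊂ {t | Function.update r i t ∈ b} := by
      refine ssubset_iff_exists.2 ⟨fun t ht => ?_, r i, ?_, fun h => hrx ⟨i, h⟩⟩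
      · exact hsub (show Function.update r i t ∈ unionCyl x from ⟨i, by simpa using ht⟩)
      · simpa using hrb
    have h := (hx i).2.2 _ (section_mem hL hM r i hb) hss
    exact h.ge (mem_univ (q i))
  · rintro ⟨k, hk⟩
    by_cases hki : k = i
    · subst hki
      exact hq ⟨k, by simpa using hk⟩
    · exact hrx ⟨k, by simpa [hki] using hk⟩

theorem exists_coatom {X : Type*} [Nonempty X] {L : Set (Set X)} (hL : IsSCS L)
    (hco : Coatomistic L) : ∃ x, IsCoatomIn L x := by
  by_contra h
  push Not at h
  have h0 := hco ∅ hL.2.1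
  simp [h] at h0
  exact empty_ne_univ h0

end Aux

section LatticeMaps

variable {X : Type*} {M : Set (Set X)}

theorem exists_singleton_image (hM : IsSCS M) {w w' : Set X → Set X}
    (hw : ∀ a ∈ M, w a ∈ M) (hw' : ∀ a ∈ M, w' a ∈ M)
    (hmono : ∀ a ∈ M, ∀ b ∈ M, a ⊆ b → w a ⊆ w b)
    (hmono' : ∀ a ∈ M, ∀ b ∈ M, a ⊆ b → w' a ⊆ w' b)
    (hinv : ∀ a ∈ M, w (w' a) = a) (hinv' : ∀ a ∈ M, w' (w a) = a) (p : X) :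
    ∃ q, w {p} = {q} := by
  have h0 : w ∅ = ∅ := by
    refine subset_empty_iff.1 ?_
    have h := hmono ∅ hM.2.1 (w' ∅) (hw' _ hM.2.1) (empty_subset _)
    rwa [hinv _ hM.2.1] at h
  have h0' : w' ∅ = ∅ := by
    have h := hinv' ∅ hM.2.1
    rwa [h0] at h
  have hpM := hM.2.2.2 p
  have hne : (w {p}).Nonempty := by
    rw [nonempty_iff_ne_empty]
    intro h
    have := hinv' _ hpM
    rw [h, h0'] at this
    exact (singleton_nonempty p).ne_empty this.symm
  obtain ⟨q, hq⟩ := hne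
  have hqM := hM.2.2.2 q
  refine ⟨q, ?_⟩
  have h1 : w' {q} ⊆ {p} := by
    have := hmono' _ hqM _ (hw _ hpM) (singleton_subset_iff.2 hq)
    rwa [hinv' _ hpM] at this
  rcases subset_singleton_iff_eq.1 h1 with h | h
  · have := hinv _ hqM
    rw [h, h0] at this
    exact absurd this.symm (singleton_nonempty q).ne_empty
  · rw [← h, hinv _ hqM]

/-- An order automorphism of a simple closure space is induced by a bijection of points. -/
theorem exists_equiv_of_orderAut (hM : IsSCS M) {w w' : Set X → Set X}
    (hw : ∀ a ∈ M, w a ∈ M) (hw' : ∀ a ∈ M, w' a ∈ M)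
    (hmono : ∀ a ∈ M, ∀ b ∈ M, a ⊆ b → w a ⊆ w b)
    (hmono' : ∀ a ∈ M, ∀ b ∈ M, a ⊆ b → w' a ⊆ w' b)
    (hinv : ∀ a ∈ M, w (w' a) = a) (hinv' : ∀ a ∈ M, w' (w a) = a) :
    ∃ v : X ≃ X, (∀ a ∈ M, v ⁻¹' a = w a) ∧ ∀ a ∈ M, v.symm ⁻¹' a = w' a := by
  choose f hf using exists_singleton_image hM hw hw' hmono hmono' hinv hinv'
  choose g hg using exists_singleton_image hM hw' hw hmono' hmono hinv' hinv
  have hfg : ∀ p, f (g p) = p := fun p => by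
    have := hinv _ (hM.2.2.2 p)
    rwa [hg, hf, singleton_eq_singleton_iff] at this
  have hgf : ∀ p, g (f p) = p := fun p => by
    have := hinv' _ (hM.2.2.2 p)
    rwa [hf, hg, singleton_eq_singleton_iff] at this
  refine ⟨⟨g, f, hfg, hgf⟩, fun a ha => ?_, fun a ha => ?_⟩
  · ext p
    change g p ∈ a ↔ p ∈ w a
    constructor
    · intro h
      have := hmono _ (hM.2.2.2 _) _ ha (singleton_subset_iff.2 h)
      rwa [hf, hfg, singleton_subset_iff] at this
    · intro h
      have := hmono' _ (hM.2.2.2 _) _ (hw _ ha) (singleton_subset_iff.2 h)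
      rwa [hg, hinv' _ ha, singleton_subset_iff] at this
  · ext p
    change f p ∈ a ↔ p ∈ w' a
    constructor
    · intro h
      have := hmono' _ (hM.2.2.2 _) _ ha (singleton_subset_iff.2 h)
      rwa [hg, hgf, singleton_subset_iff] at this
    · intro h
      have := hmono _ (hM.2.2.2 _) _ (hw' _ ha) (singleton_subset_iff.2 h)
      rwa [hf, hinv _ ha, singleton_subset_iff] at this

theorem IsOrtho.eq_sInter {N : Set X → Set X} (hN : IsOrtho M N) (hM : IsSCS M)
    {a : Set X} (ha : a ∈ M) : a = ⋂₀ {y | ∃ q ∈ N a, y = N {q}} := by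
  obtain ⟨hmem, hinv, hanti, -⟩ := hN
  have hs := hM.2.2.2
  refine Subset.antisymm ?_ fun x hx => ?_
  · rintro x hx _ ⟨q, hq, rfl⟩
    have := hanti _ (hs q) _ (hmem _ ha) (singleton_subset_iff.2 hq)
    rw [hinv _ ha] at this
    exact this hx
  · have h1 : N a ⊆ N {x} := by
      intro q hq
      have h := hanti _ (hs x) _ (hmem _ (hs q)) (singleton_subset_iff.2 (hx _ ⟨q, hq, rfl⟩))
      rw [hinv _ (hs q)] at h
      exact singleton_subset_iff.1 h
    have h2 := hanti _ (hmem _ ha) _ (hmem _ (hs x)) h1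
    rw [hinv _ ha, hinv _ (hs x)] at h2
    exact singleton_subset_iff.1 h2

theorem IsOrtho.compl_univ {N : Set X → Set X} (hN : IsOrtho M N) (hM : IsSCS M) :
    N Set.univ = ∅ := by
  obtain ⟨hmem, hinv, hanti, -⟩ := hN
  have h := hanti _ (hmem _ hM.2.1) _ hM.2.2.1 (subset_univ _)
  rw [hinv _ hM.2.1] at h
  exact subset_empty_iff.1 h

theorem IsOrtho.exists_eq_compl_singleton {N : Set X → Set X} (hN : IsOrtho M N)
    (hM : IsSCS M) {x : Set X} (hx : IsCoatomIn M x) : ∃ p, x = N {p} := by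
  have hu := hN.compl_univ hM
  obtain ⟨hmem, hinv, hanti, -⟩ := hN
  have hne : (N x).Nonempty := by
    rw [nonempty_iff_ne_empty]
    intro h
    refine hx.2.1 ?_
    rw [← hinv _ hx.1, h, ← hu, hinv _ hM.2.2.1]
  obtain ⟨p, hp⟩ := hne
  have hpM := hM.2.2.2 p
  have hsub := hanti _ hpM _ (hmem _ hx.1) (singleton_subset_iff.2 hp)
  rw [hinv _ hx.1] at hsub
  refine ⟨p, ?_⟩
  by_contra hne
  have h := hx.2.2 _ (hmem _ hpM) (hsub.ssubset_of_ne hne)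
  have h2 := hinv _ hpM
  rw [h, hu] at h2
  exact (singleton_nonempty p).ne_empty h2.symm

/-- In a transitive orthocomplemented simple closure space every complement of a point is the
preimage, under some automorphism, of a given one. -/
theorem IsOrtho.exists_equiv_preimage_compl {N : Set X → Set X} (hN : IsOrtho M N)
    (hM : IsSCS M) (htrans : TransitiveSCS M) (p q : X) :
    ∃ v : X ≃ X, (∀ a ∈ M, v ⁻¹' a ∈ M) ∧ (∀ a ∈ M, v.symm ⁻¹' a ∈ M) ∧
      v ⁻¹' N {p} = N {q} := by
  obtain ⟨hmem, hinv, hanti, -⟩ := hN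
  obtain ⟨u, hu, rfl⟩ := htrans p q
  have hu' : ∀ a ∈ M, u.symm '' a ∈ M := fun a ha => (hu _).2 (by simpa using ha)
  have hw : ∀ a ∈ M, N (u '' N a) ∈ M := fun a ha => hmem _ ((hu _).1 (hmem _ ha))
  have hw' : ∀ a ∈ M, N (u.symm '' N a) ∈ M := fun a ha => hmem _ (hu' _ (hmem _ ha))
  obtain ⟨v, hv, hv'⟩ := exists_equiv_of_orderAut (w := fun a => N (u '' N a))
    (w' := fun a => N (u.symm '' N a)) hM hw hw'
    (fun a ha b hb hab => hanti _ ((hu _).1 (hmem _ hb)) _ ((hu _).1 (hmem _ ha))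
      (image_mono (hanti _ ha _ hb hab)))
    (fun a ha b hb hab => hanti _ (hu' _ (hmem _ hb)) _ (hu' _ (hmem _ ha))
      (image_mono (hanti _ ha _ hb hab)))
    (fun a ha => by
      rw [hinv _ (hu' _ (hmem _ ha)), Equiv.image_symm_image, hinv _ ha])
    (fun a ha => by
      rw [hinv _ ((hu _).1 (hmem _ ha)), Equiv.symm_image_image, hinv _ ha])
  have hpM := hM.2.2.2 p
  refine ⟨v, fun a ha => hv a ha ▸ hw a ha, fun a ha => hv' a ha ▸ hw' a ha, ?_⟩
  rw [hv _ (hmem _ hpM), hinv _ hpM, image_singleton]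

end LatticeMaps

theorem isCoatomIn_unionCyl {n : ℕ} {σ : Fin n → Type*} {L : ∀ i, Set (Set (σ i))}
    (hL : ∀ i, IsSCS (L i)) {M : Set (Set (∀ i, σ i))} (hM : IsWTP L M)
    {x : ∀ i, Set (σ i)} (hx : ∀ i, IsCoatomIn (L i) (x i)) : IsCoatomIn M (unionCyl x) := by
  refine ⟨hM.2.1 x fun i => (hx i).1, ?_, fun c hc hss => ?_⟩
  · choose p hp using fun i => (ne_univ_iff_exists_notMem _).1 (hx i).2.1
    refine (ne_univ_iff_exists_notMem _).2 ⟨p, ?_⟩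
    rintro ⟨i, hi⟩
    exact hp i hi
  · obtain ⟨p, hpc, hpx⟩ := exists_of_ssubset hss
    exact eq_univ_of_unionCyl_subset hL hM hx hc hss.subset hpc hpx

/-- if `L₁, …, L_n` are coatomistic and weakly connected and the weak
tensor product `M ∈ S(L₁,…,L_n)` is transitive and admits an orthocomplementation, then
`M = ∧○_{i=1}^n L_i`. -/
theorem stmt16 {n : ℕ} {σ : Fin n → Type*} [∀ i, Nonempty (σ i)]
    (L : ∀ i, Set (Set (σ i))) (hL : ∀ i, IsSCS (L i))
    (hco : ∀ i, Coatomistic (L i)) (hwc : ∀ i, WeaklyConnected (L i))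
    (M : Set (Set (∀ i, σ i))) (hM : IsWTP L M)
    (htrans : TransitiveSCS M)
    (horth : ∃ N : Set (∀ i, σ i) → Set (∀ i, σ i), IsOrtho M N) :
    M = wedgeO L := by
  obtain ⟨N, hN⟩ := horth
  choose x hx using fun i => exists_coatom (hL i) (hco i)
  have hX := isCoatomIn_unionCyl hL hM hx
  obtain ⟨p, hp⟩ := hN.exists_eq_compl_singleton hM.1 hX
  ext a
  constructor
  · intro ha
    refine ⟨_, ?_, hN.eq_sInter hM.1 ha⟩
    rintro _ ⟨q, -, rfl⟩
    obtain ⟨v, hv, hv', hpq⟩ := hN.exists_equiv_preimage_compl hM.1 htrans p q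
    rw [← hpq, ← hp]
    exact preimage_unionCyl_eq hL hwc hM v hv hv' (fun i => (hx i).1) hX.2.1
  · rintro ⟨ω, hω, rfl⟩
    refine hM.1.1 ω fun y hy => ?_
    obtain ⟨b, hb, rfl⟩ := hω y hy
    exact hM.2.1 b hb

end QLTensor
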